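/- Let V₃ = (k/2)x₁² + (c₁/2)∫₀^∞ μ_{1-α₁}(ω)z₁(ω,t)²dω + (c₂/2)∫₀^∞ μ_{1-α₂}(ω)z₂(ω,t)²dω + (m/2)x₄², where ∂zᵢ/∂t = -ωzᵢ + x₄ (i=1,2), x₂ = ∫μ_{1-α₁}z₁dω, x₃ = ∫μ_{1-α₂}z₂dω, ẋ₁ = x₄, and m·ẋ₄ = -k·x₁ - c₁·x₂ - c₂·x₃. Then V̇₃ = -c₁∫₀^∞ ωμ_{1-α₁}(ω)z₁²dω - c₂∫₀^∞ ωμ_{1-α₂}(ω)z₂²dω ≤ 0. -/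

import Mathlib

open Real MeasureTheory Set

/-- Splitting of the rate of change of the stored energy of a diffusive representation into
its dissipated part and the part exchanged with the input `u`. -/
theorem integral_weight_mul_two_mul {ν : Measure ℝ} (w z : ℝ → ℝ) (u : ℝ)
    (h : Integrable (fun ω => ω * w ω * z ω ^ 2) ν)
    (h' : Integrable (fun ω => w ω * z ω) ν) :
    ∫ ω, w ω * (2 * z ω * (-ω * z ω + u)) ∂ν =
      -2 * (∫ ω, ω * w ω * z ω ^ 2 ∂ν) + 2 * u * ∫ ω, w ω * z ω ∂ν := by
  rw [← integral_const_mul, ← integral_const_mul,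
    ← integral_add (h.const_mul _) (h'.const_mul _)]
  congr 1
  ext ω
  ring

/-- The dissipation of a diffusive representation with the weight of a fractional integrator of
order `1 - α` is nonnegative. -/
theorem integral_dissipation_nonneg {α : ℝ} (h₀ : 0 ≤ α) (h₁ : α ≤ 1) (z : ℝ → ℝ) :
    0 ≤ ∫ ω in Set.Ioi (0:ℝ),
      ω * ((Real.sin ((1 - α) * π) / π) * ω ^ (α - 1)) * z ω ^ 2 := by
  have hsin : 0 ≤ Real.sin ((1 - α) * π) :=
    Real.sin_nonneg_of_nonneg_of_le_pi (mul_nonneg (by linarith) Real.pi_pos.le)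
      (mul_le_of_le_one_left Real.pi_pos.le (by linarith))
  refine setIntegral_nonneg measurableSet_Ioi fun ω hω => ?_
  have hω' : 0 < ω := hω
  positivity

theorem stmt_13 (k c₁ c₂ m α₁ α₂ : ℝ)
    (hk : 0 < k) (hc₁ : 0 < c₁) (hc₂ : 0 < c₂) (hm : 0 < m)
    (hα : 0 < α₁ ∧ α₁ < α₂ ∧ α₂ < 1)
    (x₁ x₂ x₃ x₄ : ℝ → ℝ) (z₁ z₂ : ℝ → ℝ → ℝ) (t : ℝ)
    (hz₁ : ∀ ω, 0 < ω → HasDerivAt (z₁ ω) (-ω * z₁ ω t + x₄ t) t)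
    (hz₂ : ∀ ω, 0 < ω → HasDerivAt (z₂ ω) (-ω * z₂ ω t + x₄ t) t)
    (hx₂ : x₂ t = ∫ ω in Set.Ioi (0:ℝ),
      (Real.sin ((1 - α₁) * π) / π) * ω ^ (α₁ - 1) * z₁ ω t)
    (hx₃ : x₃ t = ∫ ω in Set.Ioi (0:ℝ),
      (Real.sin ((1 - α₂) * π) / π) * ω ^ (α₂ - 1) * z₂ ω t)
    (hx₁ : HasDerivAt x₁ (x₄ t) t)
    (hx₄ : HasDerivAt x₄ ((-k * x₁ t - c₁ * x₂ t - c₂ * x₃ t) / m) t)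
    (hswap₁ : HasDerivAt
      (fun τ => ∫ ω in Set.Ioi (0:ℝ),
        (Real.sin ((1 - α₁) * π) / π) * ω ^ (α₁ - 1) * (z₁ ω τ) ^ 2)
      (∫ ω in Set.Ioi (0:ℝ),
        (Real.sin ((1 - α₁) * π) / π) * ω ^ (α₁ - 1) *
          (2 * z₁ ω t * (-ω * z₁ ω t + x₄ t))) t)
    (hswap₂ : HasDerivAt
      (fun τ => ∫ ω in Set.Ioi (0:ℝ),
        (Real.sin ((1 - α₂) * π) / π) * ω ^ (α₂ - 1) * (z₂ ω τ) ^ 2)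
      (∫ ω in Set.Ioi (0:ℝ),
        (Real.sin ((1 - α₂) * π) / π) * ω ^ (α₂ - 1) *
          (2 * z₂ ω t * (-ω * z₂ ω t + x₄ t))) t)
    (hint₁ : Integrable
      (fun ω => ω * ((Real.sin ((1 - α₁) * π) / π) * ω ^ (α₁ - 1)) * (z₁ ω t) ^ 2)
      (volume.restrict (Set.Ioi (0:ℝ))))
    (hint₂ : Integrable
      (fun ω => ω * ((Real.sin ((1 - α₂) * π) / π) * ω ^ (α₂ - 1)) * (z₂ ω t) ^ 2)
      (volume.restrict (Set.Ioi (0:ℝ))))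
    (hint₁' : Integrable (fun ω => (Real.sin ((1 - α₁) * π) / π) * ω ^ (α₁ - 1) * z₁ ω t)
      (volume.restrict (Set.Ioi (0:ℝ))))
    (hint₂' : Integrable (fun ω => (Real.sin ((1 - α₂) * π) / π) * ω ^ (α₂ - 1) * z₂ ω t)
      (volume.restrict (Set.Ioi (0:ℝ)))) :
    HasDerivAt
      (fun τ => (k / 2) * (x₁ τ) ^ 2 +
        (c₁ / 2) * (∫ ω in Set.Ioi (0:ℝ),
          (Real.sin ((1 - α₁) * π) / π) * ω ^ (α₁ - 1) * (z₁ ω τ) ^ 2) +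
        (c₂ / 2) * (∫ ω in Set.Ioi (0:ℝ),
          (Real.sin ((1 - α₂) * π) / π) * ω ^ (α₂ - 1) * (z₂ ω τ) ^ 2) +
        (m / 2) * (x₄ τ) ^ 2)
      (-c₁ * (∫ ω in Set.Ioi (0:ℝ),
          ω * ((Real.sin ((1 - α₁) * π) / π) * ω ^ (α₁ - 1)) * (z₁ ω t) ^ 2) -
        c₂ * (∫ ω in Set.Ioi (0:ℝ),
          ω * ((Real.sin ((1 - α₂) * π) / π) * ω ^ (α₂ - 1)) * (z₂ ω t) ^ 2)) t ∧
    (-c₁ * (∫ ω in Set.Ioi (0:ℝ),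
        ω * ((Real.sin ((1 - α₁) * π) / π) * ω ^ (α₁ - 1)) * (z₁ ω t) ^ 2) -
      c₂ * (∫ ω in Set.Ioi (0:ℝ),
        ω * ((Real.sin ((1 - α₂) * π) / π) * ω ^ (α₂ - 1)) * (z₂ ω t) ^ 2)) ≤ 0 := by
  obtain ⟨hα₁, hα₁₂, hα₂⟩ := hα
  constructor
  · rw [integral_weight_mul_two_mul _ _ _ hint₁ hint₁', ← hx₂] at hswap₁
    rw [integral_weight_mul_two_mul _ _ _ hint₂ hint₂', ← hx₃] at hswap₂
    refine HasDerivAt.congr_deriv (((((hx₁.fun_pow 2).const_mul (k / 2)).fun_add (hswap₁.const_mul (c₁ / 2))).fun_add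
      (hswap₂.const_mul (c₂ / 2))).fun_add ((hx₄.fun_pow 2).const_mul (m / 2))) ?_
    generalize (∫ ω in Set.Ioi (0:ℝ),
      ω * ((Real.sin ((1 - α₁) * π) / π) * ω ^ (α₁ - 1)) * (z₁ ω t) ^ 2) = I₁
    generalize (∫ ω in Set.Ioi (0:ℝ),
      ω * ((Real.sin ((1 - α₂) * π) / π) * ω ^ (α₂ - 1)) * (z₂ ω t) ^ 2) = I₂
    field_simp
    ring
  · have h₁ := mul_nonneg hc₁.le
      (integral_dissipation_nonneg hα₁.le (hα₁₂.trans hα₂).le fun ω => z₁ ω t)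
    have h₂ := mul_nonneg hc₂.le
      (integral_dissipation_nonneg (hα₁.trans hα₁₂).le hα₂.le fun ω => z₂ ω t)
    linarith
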